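/- (Determinant representation of the N-fold Darboux transformation.) Under the N-fold Darboux recursion, suppose in addition that the N×N matrix M with entries M_{jk} = Ψ_j†Ψ_k/(ζ_k − ζ_j*) is invertible at every (x, t). Then for every ζ outside {ζ₁*, …, ζ_N*}, T_N(ζ) = T[N](ζ)⋯T[1](ζ) = I − X M⁻¹ S(ζ)⁻¹ X†, where X = (Ψ₁, …, Ψ_N) is the 4×N matrix whose columns are the seed eigenfunctions and S(ζ) = diag(ζ − ζ₁*, …, ζ − ζ_N*). -/

import Mathlib

open Matrix Filter Topology

noncomputable section

/-- Partial derivative in the first (space) variable. -/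
def dX (f : ℝ × ℝ → ℂ) : ℝ × ℝ → ℂ := fun p => deriv (fun x => f (x, p.2)) p.1

/-- Partial derivative in the second (time) variable. -/
def dT (f : ℝ × ℝ → ℂ) : ℝ × ℝ → ℂ := fun p => deriv (fun t => f (p.1, t)) p.2

/-- Left-hand side of one component of the vcmKdV equation
`f_t + f_xxx + 3((q†q) f_x + (q†q_x) f)` for `q = (u,v,w)ᵀ`. -/
def vcmLHS (u v w f : ℝ × ℝ → ℂ) (p : ℝ × ℝ) : ℂ :=
  dT f p + dX (dX (dX f)) p
    + 3 * (((starRingEnd ℂ) (u p) * u p + (starRingEnd ℂ) (v p) * v p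
            + (starRingEnd ℂ) (w p) * w p) * dX f p
         + ((starRingEnd ℂ) (u p) * dX u p + (starRingEnd ℂ) (v p) * dX v p
            + (starRingEnd ℂ) (w p) * dX w p) * f p)

/-- The vector complex modified KdV equation
`q_t + q_xxx + 3(q_x q† q + q q† q_x) = 0` for `q = (u,v,w)ᵀ`. -/
def vcmKdVeq (u v w : ℝ × ℝ → ℂ) : Prop :=
  ∀ p : ℝ × ℝ, vcmLHS u v w u p = 0 ∧ vcmLHS u v w v p = 0 ∧ vcmLHS u v w w p = 0

/-- `J = diag(1, -1, -1, -1)`. -/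
def Jmat : Matrix (Fin 4) (Fin 4) ℂ := Matrix.diagonal ![1, -1, -1, -1]

/-- The potential matrix `Q` built from the entries `u, v, w`. -/
def Qmat (u v w : ℂ) : Matrix (Fin 4) (Fin 4) ℂ :=
  !![0, u, v, w;
     -((starRingEnd ℂ) u), 0, 0, 0;
     -((starRingEnd ℂ) v), 0, 0, 0;
     -((starRingEnd ℂ) w), 0, 0, 0]

/-- `U(ζ) = -iζJ + Q`. -/
def Umat (ζ u v w : ℂ) : Matrix (Fin 4) (Fin 4) ℂ :=
  (-Complex.I * ζ) • Jmat + Qmat u v w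

/-- `V(ζ) = -4iζ³J + 4ζ²Q - 2iζ(Q² + Q_x)J + (-Q_xx + 2Q³ + Q_x Q - Q Q_x)`. -/
def Vmat (ζ u v w ux vx wx uxx vxx wxx : ℂ) : Matrix (Fin 4) (Fin 4) ℂ :=
  (-4 * Complex.I * ζ ^ 3) • Jmat + (4 * ζ ^ 2) • Qmat u v w
    - (2 * Complex.I * ζ) • ((Qmat u v w ^ 2 + Qmat ux vx wx) * Jmat)
    + (-Qmat uxx vxx wxx + 2 * Qmat u v w ^ 3
        + Qmat ux vx wx * Qmat u v w - Qmat u v w * Qmat ux vx wx)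

/-- `U(ζ)` as a matrix-valued field on `ℝ²`. -/
def Ufield (u v w : ℝ × ℝ → ℂ) (ζ : ℂ) (p : ℝ × ℝ) : Matrix (Fin 4) (Fin 4) ℂ :=
  Umat ζ (u p) (v p) (w p)

/-- `V(ζ)` as a matrix-valued field on `ℝ²` (with `Q_x`, `Q_xx` the entrywise derivatives). -/
def Vfield (u v w : ℝ × ℝ → ℂ) (ζ : ℂ) (p : ℝ × ℝ) : Matrix (Fin 4) (Fin 4) ℂ :=
  Vmat ζ (u p) (v p) (w p) (dX u p) (dX v p) (dX w p)
    (dX (dX u) p) (dX (dX v) p) (dX (dX w) p)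

/-- Entrywise `x`-derivative of a matrix-valued field. -/
def dXM (F : ℝ × ℝ → Matrix (Fin 4) (Fin 4) ℂ) (p : ℝ × ℝ) : Matrix (Fin 4) (Fin 4) ℂ :=
  Matrix.of fun i j => deriv (fun x => F (x, p.2) i j) p.1

/-- Entrywise `t`-derivative of a matrix-valued field. -/
def dTM (F : ℝ × ℝ → Matrix (Fin 4) (Fin 4) ℂ) (p : ℝ × ℝ) : Matrix (Fin 4) (Fin 4) ℂ :=
  Matrix.of fun i j => deriv (fun t => F (p.1, t) i j) p.2

/-- `Ψ` solves the Lax pair `Ψ_x = U(ζ)Ψ`, `Ψ_t = V(ζ)Ψ` with potentials `(u,v,w)`. -/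
def SolvesLax (u v w : ℝ × ℝ → ℂ) (ζ : ℂ) (Ψ : ℝ × ℝ → Fin 4 → ℂ) : Prop :=
  ∀ p : ℝ × ℝ,
    HasDerivAt (fun x => Ψ (x, p.2)) ((Ufield u v w ζ p).mulVec (Ψ p)) p.1 ∧
    HasDerivAt (fun t => Ψ (p.1, t)) ((Vfield u v w ζ p).mulVec (Ψ p)) p.2

/-- The rank-one projection `ψψ†/(ψ†ψ)`. -/
def projOf (ψ : Fin 4 → ℂ) : Matrix (Fin 4) (Fin 4) ℂ :=
  (star ψ ⬝ᵥ ψ)⁻¹ • vecMulVec ψ (star ψ)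

/-- One-fold Darboux matrix `T(ζ) = I - ((ζ₁ - ζ₁*)/(ζ - ζ₁*)) ψψ†/(ψ†ψ)`. -/
def Tone (ζ₁ ζ : ℂ) (ψ : Fin 4 → ℂ) : Matrix (Fin 4) (Fin 4) ℂ :=
  1 - ((ζ₁ - (starRingEnd ℂ) ζ₁) / (ζ - (starRingEnd ℂ) ζ₁)) • projOf ψ

/-- Transformed potential `f - 2i(ζ₁ - ζ₁*) Ψ₁⁰ (Ψ₁ʲ)* / (Ψ₁†Ψ₁)` of the one-fold DT. -/
def u1of (f : ℝ × ℝ → ℂ) (ζ₁ : ℂ) (Ψ₁ : ℝ × ℝ → Fin 4 → ℂ) (j : Fin 4) : ℝ × ℝ → ℂ :=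
  fun p => f p - 2 * Complex.I * (ζ₁ - (starRingEnd ℂ) ζ₁) * Ψ₁ p 0
      * (starRingEnd ℂ) (Ψ₁ p j) / (star (Ψ₁ p) ⬝ᵥ Ψ₁ p)

/-- The iterated eigenfunctions `Ψ_i^{(k)}` of the `N`-fold Darboux recursion
(0-based indexing: `PsiIter ζs Ψs k i = Ψ_{i+1}^{(k)}`). -/
def PsiIter (ζs : ℕ → ℂ) (Ψs : ℕ → ℝ × ℝ → Fin 4 → ℂ) : ℕ → ℕ → ℝ × ℝ → Fin 4 → ℂ
  | 0, i => Ψs i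
  | k + 1, i => fun p =>
      (Tone (ζs k) (ζs i) (PsiIter ζs Ψs k k p)).mulVec (PsiIter ζs Ψs k i p)

/-- The product `T_N(ζ) = T[N](ζ) ⋯ T[1](ζ)` of the `N`-fold Darboux recursion. -/
def TNmat (ζs : ℕ → ℂ) (Ψs : ℕ → ℝ × ℝ → Fin 4 → ℂ) :
    ℕ → ℂ → ℝ × ℝ → Matrix (Fin 4) (Fin 4) ℂ
  | 0, _, _ => 1
  | k + 1, ζ, p => Tone (ζs k) ζ (PsiIter ζs Ψs k k p) * TNmat ζs Ψs k ζ p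

/-- The explicit eigenfunction of the Lax pair for the zero seed at eigenvalue `ζk`. -/
def seedPsi (ζk : ℂ) (c₁ c₂ c₃ : ℝ) (p : ℝ × ℝ) : Fin 4 → ℂ :=
  ![Complex.exp (-Complex.I * ζk * (4 * p.2 * ζk ^ 2 + p.1)),
    c₁ * Complex.exp (Complex.I * ζk * (4 * p.2 * ζk ^ 2 + p.1)),
    c₂ * Complex.exp (Complex.I * ζk * (4 * p.2 * ζk ^ 2 + p.1)),
    c₃ * Complex.exp (Complex.I * ζk * (4 * p.2 * ζk ^ 2 + p.1))]

/-- The `N×N` matrix `M` with entries `M_{jk} = Ψ_j†Ψ_k/(ζ_k - ζ_j*)`. -/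
def MmatOf {N : ℕ} (ζs : Fin N → ℂ) (Ψs : Fin N → ℝ × ℝ → Fin 4 → ℂ) (p : ℝ × ℝ) :
    Matrix (Fin N) (Fin N) ℂ :=
  Matrix.of fun j k => (star (Ψs j p) ⬝ᵥ Ψs k p) / (ζs k - (starRingEnd ℂ) (ζs j))

/-- The `4×N` matrix `X = (Ψ₁, …, Ψ_N)` whose columns are the eigenfunctions. -/
def XmatOf {N : ℕ} (Ψs : Fin N → ℝ × ℝ → Fin 4 → ℂ) (p : ℝ × ℝ) :
    Matrix (Fin 4) (Fin N) ℂ :=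
  Matrix.of fun a j => Ψs j p a

/-- `M` bordered on the right by the column `c` and at the bottom by the row `(r, 0)`. -/
def bordered {N : ℕ} (M : Matrix (Fin N) (Fin N) ℂ) (c r : Fin N → ℂ) :
    Matrix (Fin (N + 1)) (Fin (N + 1)) ℂ :=
  Matrix.of fun i j =>
    Fin.lastCases
      (Fin.lastCases (0 : ℂ) (fun j' => r j') j)
      (fun i' => Fin.lastCases (c i') (fun j' => M i' j') j)
      i

theorem projOf_mul_self (ψ : Fin 4 → ℂ) : projOf ψ * projOf ψ = projOf ψ := by
  rcases eq_or_ne (star ψ ⬝ᵥ ψ) 0 with h | h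
  · simp [projOf, h]
  · simp only [projOf, smul_mul_assoc, mul_smul_comm, vecMulVec_mul_vecMulVec,
      vecMulVec_smul, smul_smul]
    congr 1
    field_simp

theorem conjTranspose_projOf (ψ : Fin 4 → ℂ) : (projOf ψ)ᴴ = projOf ψ := by
  rw [projOf, conjTranspose_smul, conjTranspose_vecMulVec, star_star, star_inv₀,
    ← star_dotProduct]

open scoped ComplexOrder in
theorem projOf_mulVec_self {ψ : Fin 4 → ℂ} (hψ : ψ ≠ 0) : projOf ψ *ᵥ ψ = ψ := by
  have h : star ψ ⬝ᵥ ψ ≠ 0 :=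
    dotProduct_comm ψ (star ψ) ▸ dotProduct_star_self_eq_zero.not.2 hψ
  ext i
  simp only [projOf, smul_mulVec, vecMulVec_mulVec, Pi.smul_apply, smul_eq_mul,
    MulOpposite.smul_eq_mul_unop, MulOpposite.unop_op]
  field_simp

theorem Tone_mulVec_self {z : ℂ} (hz : z ≠ starRingEnd ℂ z) {ψ : Fin 4 → ℂ} (hψ : ψ ≠ 0) :
    Tone z z ψ *ᵥ ψ = 0 := by
  rw [Tone, div_self (sub_ne_zero.2 hz), one_smul, sub_mulVec, one_mulVec,
    projOf_mulVec_self hψ, sub_self]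

theorem conjTranspose_Tone_mul_Tone {z ζ : ℂ} (h₁ : ζ ≠ starRingEnd ℂ z) (h₂ : ζ ≠ z)
    (ψ : Fin 4 → ℂ) : (Tone z ζ ψ)ᴴ * Tone z (starRingEnd ℂ ζ) ψ = 1 := by
  have h₁' : starRingEnd ℂ ζ - z ≠ 0 :=
    sub_ne_zero.2 fun h => h₁ (by rw [← h, Complex.conj_conj])
  have h₂' : starRingEnd ℂ ζ - starRingEnd ℂ z ≠ 0 :=
    sub_ne_zero.2 fun h => h₂ ((starRingEnd ℂ).injective h)
  have key : ∀ a b : ℂ, a + b = a * b →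
      (1 - a • projOf ψ) * (1 - b • projOf ψ) = 1 := by
    intro a b hab
    have : (1 - a • projOf ψ) * (1 - b • projOf ψ)
        = 1 - (a + b - a * b) • projOf ψ := by
      simp only [sub_mul, mul_sub, one_mul, mul_one, smul_mul_assoc, mul_smul_comm,
        projOf_mul_self]
      module
    rw [this, hab, sub_self, zero_smul, sub_zero]
  rw [Tone, Tone, conjTranspose_sub, conjTranspose_one, conjTranspose_smul, conjTranspose_projOf]
  apply key
  simp only [star_div₀, star_sub, Complex.star_def, Complex.conj_conj]
  field_simp
  ring

theorem conjTranspose_TNmat_mul_TNmat (ζs : ℕ → ℂ) (Ψs : ℕ → ℝ × ℝ → Fin 4 → ℂ) (p : ℝ × ℝ)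
    {ζ : ℂ} (n : ℕ) (h₁ : ∀ i < n, ζ ≠ starRingEnd ℂ (ζs i)) (h₂ : ∀ i < n, ζ ≠ ζs i) :
    (TNmat ζs Ψs n ζ p)ᴴ * TNmat ζs Ψs n (starRingEnd ℂ ζ) p = 1 := by
  induction n with
  | zero => simp [TNmat]
  | succ k ih =>
    simp only [TNmat, conjTranspose_mul]
    rw [Matrix.mul_assoc, ← Matrix.mul_assoc _ (Tone _ _ _),
      conjTranspose_Tone_mul_Tone (h₁ k k.lt_succ_self) (h₂ k k.lt_succ_self), Matrix.one_mul]
    exact ih (fun i hi => h₁ i (hi.trans k.lt_succ_self))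
      (fun i hi => h₂ i (hi.trans k.lt_succ_self))

theorem PsiIter_eq_TNmat_mulVec (ζs : ℕ → ℂ) (Ψs : ℕ → ℝ × ℝ → Fin 4 → ℂ) (p : ℝ × ℝ)
    (n i : ℕ) : PsiIter ζs Ψs n i p = TNmat ζs Ψs n (ζs i) p *ᵥ Ψs i p := by
  induction n with
  | zero => simp [PsiIter, TNmat]
  | succ k ih => rw [TNmat, ← mulVec_mulVec, ← ih, PsiIter]

theorem TNmat_mulVec_eq_zero (ζs : ℕ → ℂ) (Ψs : ℕ → ℝ × ℝ → Fin 4 → ℂ) (p : ℝ × ℝ)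
    {i : ℕ} (hi : ζs i ≠ starRingEnd ℂ (ζs i)) (hψ : PsiIter ζs Ψs i i p ≠ 0)
    {n : ℕ} (hn : i < n) : TNmat ζs Ψs n (ζs i) p *ᵥ Ψs i p = 0 := by
  induction n, hn using Nat.le_induction with
  | base => rw [TNmat, ← mulVec_mulVec, ← PsiIter_eq_TNmat_mulVec, Tone_mulVec_self hi hψ]
  | succ k _ ih => rw [TNmat, ← mulVec_mulVec, ih, mulVec_zero]

/-- Partial fraction expansion of `T_n(ζ)`: the residue at `ζ_j*` is a rank-one matrix with row
space spanned by `Ψ_j†`. -/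
theorem exists_TNmat_eq_one_sub_sum (ζs : ℕ → ℂ) (Ψs : ℕ → ℝ × ℝ → Fin 4 → ℂ) (p : ℝ × ℝ)
    (n : ℕ) (hdist : ∀ i j, i < n → j < n → i ≠ j → ζs i ≠ ζs j)
    (hnc : ∀ i j, i < n → j < n → ζs i ≠ starRingEnd ℂ (ζs j)) :
    ∃ y : ℕ → Fin 4 → ℂ, ∀ ζ : ℂ, (∀ i < n, ζ ≠ starRingEnd ℂ (ζs i)) →
      TNmat ζs Ψs n ζ p = 1 - ∑ j ∈ Finset.range n,
        (ζ - starRingEnd ℂ (ζs j))⁻¹ • vecMulVec (y j) (star (Ψs j p)) := by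
  induction n with
  | zero => exact ⟨0, fun ζ _ => by simp [TNmat]⟩
  | succ k ih =>
    have hlt : ∀ {i}, i < k → i < k + 1 := fun h => h.trans k.lt_succ_self
    obtain ⟨y, hy⟩ := ih (fun i j hi hj => hdist i j (hlt hi) (hlt hj))
      (fun i j hi hj => hnc i j (hlt hi) (hlt hj))
    set φ := PsiIter ζs Ψs k k p with hφ
    set a := starRingEnd ℂ (ζs k) with ha
    have hak : ∀ i < k, a ≠ starRingEnd ℂ (ζs i) := fun i hi h =>
      hdist k i k.lt_succ_self (hlt hi) hi.ne' ((starRingEnd ℂ).injective h)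
    have hres : projOf φ * TNmat ζs Ψs k a p
        = vecMulVec ((star φ ⬝ᵥ φ)⁻¹ • φ) (star (Ψs k p)) := by
      have : star φ ᵥ* TNmat ζs Ψs k a p = star (Ψs k p) := by
        rw [hφ, PsiIter_eq_TNmat_mulVec, star_mulVec, vecMul_vecMul,
          conjTranspose_TNmat_mul_TNmat ζs Ψs p k
            (fun i hi => hnc k i k.lt_succ_self (hlt hi))
            (fun i hi => hdist k i k.lt_succ_self (hlt hi) hi.ne'), vecMul_one]
      rw [projOf, smul_mul_assoc, vecMulVec_mul, this, smul_vecMulVec]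
    refine ⟨fun j => if j = k then ((ζs k - a) * (star φ ⬝ᵥ φ)⁻¹) • φ
      else Tone (ζs k) (starRingEnd ℂ (ζs j)) φ *ᵥ y j, fun ζ hζ => ?_⟩
    have hζa : ζ - a ≠ 0 := sub_ne_zero.2 (hζ k k.lt_succ_self)
    beta_reduce
    rw [Finset.sum_range_succ, if_pos rfl]
    have hlast : vecMulVec (((ζs k - a) * (star φ ⬝ᵥ φ)⁻¹) • φ) (star (Ψs k p))
        = (ζs k - a) • (projOf φ * TNmat ζs Ψs k a p) := by
      rw [hres, mul_smul, smul_vecMulVec]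
    rw [hlast, hy a hak, TNmat, hy ζ fun i hi => hζ i (hlt hi), ← hφ]
    have hterm : ∀ j ∈ Finset.range k, (ζ - starRingEnd ℂ (ζs j))⁻¹ •
        vecMulVec (if j = k then ((ζs k - a) * (star φ ⬝ᵥ φ)⁻¹) • φ
          else Tone (ζs k) (starRingEnd ℂ (ζs j)) φ *ᵥ y j) (star (Ψs j p))
        = Tone (ζs k) ζ φ * ((ζ - starRingEnd ℂ (ζs j))⁻¹ • vecMulVec (y j) (star (Ψs j p)))
          + ((ζ - a)⁻¹ * (ζs k - a)) • (projOf φ *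
            ((a - starRingEnd ℂ (ζs j))⁻¹ • vecMulVec (y j) (star (Ψs j p)))) := by
      intro j hj
      have hjk := Finset.mem_range.1 hj
      have h₁ : a - starRingEnd ℂ (ζs j) ≠ 0 := sub_ne_zero.2 (hak j hjk)
      have h₂ : starRingEnd ℂ (ζs j) - a ≠ 0 := sub_ne_zero.2 (hak j hjk).symm
      have h₃ : ζ - starRingEnd ℂ (ζs j) ≠ 0 := sub_ne_zero.2 (hζ j (hlt hjk))
      rw [if_neg hjk.ne, ← mul_vecMulVec, Tone, Tone, ← ha]
      simp only [sub_mul, one_mul, smul_mul_assoc, mul_smul_comm, smul_sub, smul_smul]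
      rw [sub_add, ← sub_smul]
      congr 2
      field_simp
      ring
    rw [Finset.sum_congr rfl hterm, Finset.sum_add_distrib, ← Finset.mul_sum, ← Finset.smul_sum,
      ← Finset.mul_sum]
    generalize (∑ j ∈ Finset.range k,
      (ζ - starRingEnd ℂ (ζs j))⁻¹ • vecMulVec (y j) (star (Ψs j p))) = A
    generalize (∑ j ∈ Finset.range k,
      (a - starRingEnd ℂ (ζs j))⁻¹ • vecMulVec (y j) (star (Ψs j p))) = B
    rw [Matrix.mul_sub, Matrix.mul_sub, Matrix.mul_one, Matrix.mul_one, smul_smul, smul_sub,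
      show Tone (ζs k) ζ φ = 1 - ((ζ - a)⁻¹ * (ζs k - a)) • projOf φ by
      rw [Tone, ← ha, div_eq_inv_mul], ← ha]
    abel

/-- determinant representation of the `N`-fold Darboux matrix:
`T_N(ζ) = I - X M⁻¹ S(ζ)⁻¹ X†`. -/
theorem TN_determinant_representation (N : ℕ) (ζs : ℕ → ℂ) (Ψs : ℕ → ℝ × ℝ → Fin 4 → ℂ)
    (u v w : ℝ × ℝ → ℂ)
    (hu : ContDiff ℝ (⊤ : ℕ∞) u) (hv : ContDiff ℝ (⊤ : ℕ∞) v)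
    (hw : ContDiff ℝ (⊤ : ℕ∞) w) (hsol : vcmKdVeq u v w)
    (hdist : ∀ i j, i < N → j < N → i ≠ j → ζs i ≠ ζs j)
    (hnc : ∀ i j, i < N → j < N → ζs i ≠ (starRingEnd ℂ) (ζs j))
    (hlax : ∀ i, i < N → SolvesLax u v w (ζs i) (Ψs i))
    (hnz : ∀ i, i < N → ∀ p : ℝ × ℝ, Ψs i p ≠ 0)
    (hiter : ∀ k, k < N → ∀ p : ℝ × ℝ, PsiIter ζs Ψs k k p ≠ 0)
    (hM : ∀ p : ℝ × ℝ,
      IsUnit (MmatOf (fun j : Fin N => ζs j.val) (fun j : Fin N => Ψs j.val) p)) :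
    ∀ ζ : ℂ, (∀ i : Fin N, ζ ≠ (starRingEnd ℂ) (ζs i.val)) → ∀ p : ℝ × ℝ,
      TNmat ζs Ψs N ζ p
        = 1 - XmatOf (fun j : Fin N => Ψs j.val) p
            * (MmatOf (fun j : Fin N => ζs j.val) (fun j : Fin N => Ψs j.val) p)⁻¹
            * (Matrix.diagonal fun j : Fin N => ζ - (starRingEnd ℂ) (ζs j.val))⁻¹
            * (XmatOf (fun j : Fin N => Ψs j.val) p)ᴴ := by
  intro ζ hζ p
  obtain ⟨y, hy⟩ := exists_TNmat_eq_one_sub_sum ζs Ψs p N hdist hnc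
  set M := MmatOf (fun j : Fin N => ζs j.val) (fun j : Fin N => Ψs j.val) p with hMdef
  set X := XmatOf (fun j : Fin N => Ψs j.val) p with hX
  let Y : Matrix (Fin 4) (Fin N) ℂ := of fun a j => y j a
  have hYM : Y * M = X := by
    ext a k
    have h := TNmat_mulVec_eq_zero ζs Ψs p (hnc k k k.2 k.2) (hiter k k.2 p) k.2
    rw [hy _ fun i hi => hnc k i k.2 hi, sub_mulVec, one_mulVec, sub_eq_zero] at h
    have h' := congrFun h a
    rw [← Fin.sum_univ_eq_sum_range (fun j => (ζs k - starRingEnd ℂ (ζs j))⁻¹ •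
      vecMulVec (y j) (star (Ψs j p))), sum_mulVec, Finset.sum_apply] at h'
    simp only [hX, XmatOf, of_apply, h', Matrix.mul_apply, Y, hMdef, MmatOf]
    refine Finset.sum_congr rfl fun j _ => ?_
    simp only [smul_mulVec, vecMulVec_mulVec, Pi.smul_apply, smul_eq_mul,
      MulOpposite.smul_eq_mul_unop, MulOpposite.unop_op]
    ring
  have hY : X * M⁻¹ = Y := by
    rw [← hYM, Matrix.mul_nonsing_inv_cancel_right _ _ ((isUnit_iff_isUnit_det _).1 (hM p))]
  have hS : (diagonal fun j : Fin N => ζ - starRingEnd ℂ (ζs j.val))⁻¹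
      = diagonal fun j : Fin N => (ζ - starRingEnd ℂ (ζs j.val))⁻¹ := by
    apply inv_eq_left_inv
    rw [diagonal_mul_diagonal, ← diagonal_one]
    exact congrArg _ (funext fun j => inv_mul_cancel₀ (sub_ne_zero.2 (hζ j)))
  rw [hY, hS, hy ζ fun i hi => hζ ⟨i, hi⟩]
  congr 1
  rw [← Fin.sum_univ_eq_sum_range (fun j => (ζ - starRingEnd ℂ (ζs j))⁻¹ •
      vecMulVec (y j) (star (Ψs j p)))]
  ext a b
  rw [Matrix.sum_apply, Matrix.mul_apply]
  refine Finset.sum_congr rfl fun j _ => ?_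
  simp only [mul_diagonal, Matrix.smul_apply, vecMulVec_apply, conjTranspose_apply, hX, XmatOf, of_apply,
    Y, Pi.star_apply, smul_eq_mul]
  ring

end
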